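/- arXiv:math/0303101 — 6 statements merged into one kernel-verified Lean document; each statement's English description precedes it below -/
import Mathlib

section
/- Let n, r, k be natural numbers, let f₁,…,f_k be complex analytic functions on a neighborhood of 0 in ℂⁿ, and let F be a complex analytic function on a neighborhood of (0,0) in ℂⁿ × ℂʳ. Assume that for every s in some neighborhood of 0 in ℂʳ there exist a neighborhood V_s of 0 in ℂⁿ and complex analytic functions G₁ˢ,…,G_kˢ on V_s with F(x,s) = Σ_{i=1}^{k} G_iˢ(x)·f_i(x) for all x ∈ V_s. Then there exist a neighborhood Ω of (0,0) in ℂⁿ × ℂʳ and complex analytic functions G₁,…,G_k on Ω with F(x,s) = Σ_{i=1}^{k} G_i(x,s)·f_i(x) for all (x,s) ∈ Ω. -/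
namespace ConvergentSeries

open Filter Topology
open scoped NNReal ENNReal

section Godel

variable {σ : Type*} [Fintype σ]

/-- An injective labelling of a finite type by prime numbers. -/
noncomputable def primeLabel (i : σ) : ℕ := Nat.nth Nat.Prime (Fintype.equivFin σ i)

lemma prime_primeLabel (i : σ) : (primeLabel i).Prime :=
  Nat.nth_mem_of_infinite Nat.infinite_setOfPred_prime _

lemma primeLabel_injective : Function.Injective (primeLabel : σ → ℕ) := fun _ _ h =>
  (Fintype.equivFin σ).injective
    (Fin.ext ((Nat.nth_strictMono Nat.infinite_setOfPred_prime).injective h))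

/-- The Gödel number `∏ pᵢ ^ βᵢ` of an exponent `β`. It totally orders the monomials. -/
noncomputable def godel (β : σ →₀ ℕ) : ℕ := β.prod fun i k => primeLabel i ^ k

lemma godel_add (β γ : σ →₀ ℕ) : godel (β + γ) = godel β * godel γ :=
  Finsupp.prod_add_index' (fun _ => pow_zero _) (fun _ _ _ => pow_add _ _ _)

lemma godel_pos (β : σ →₀ ℕ) : 0 < godel β :=
  Finset.prod_pos fun i _ => pow_pos (prime_primeLabel i).pos _

lemma godel_injective : Function.Injective (godel : (σ →₀ ℕ) → ℕ) := by
  have key (β : σ →₀ ℕ) :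
      (godel β).factorization = β.embDomain ⟨primeLabel, primeLabel_injective⟩ := by
    rw [← Nat.prod_pow_factorization_eq_self
      (f := β.embDomain ⟨primeLabel, primeLabel_injective⟩), Finsupp.prod_embDomain]
    · rfl
    · intro p hp
      rw [Finsupp.support_embDomain, Finset.mem_map] at hp
      obtain ⟨i, -, rfl⟩ := hp
      exact prime_primeLabel i
  intro β γ h
  exact Finsupp.embDomain_injective _ (by rw [← key, ← key, h])

lemma godel_le_of_le {β γ : σ →₀ ℕ} (h : β ≤ γ) : godel β ≤ godel γ := by
  obtain ⟨δ, rfl⟩ := exists_add_of_le h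
  rw [godel_add]
  exact Nat.le_mul_of_pos_right _ (godel_pos δ)

lemma finite_godel_le (K : ℕ) : {β : σ →₀ ℕ | godel β ≤ K}.Finite :=
  (Set.finite_Iic K).preimage godel_injective.injOn

lemma godel_lt_of_add_eq {α β γ δ : σ →₀ ℕ} (h : β + δ = γ) (hδ : godel α < godel δ) :
    godel (β + α) < godel γ := by
  rw [← h, godel_add, godel_add]
  exact Nat.mul_lt_mul_of_pos_left hδ (godel_pos β)

/-- The value at `x` of the monomial with exponent `β`. -/
noncomputable def monoEval (x : σ → ℂ) (β : σ →₀ ℕ) : ℂ := β.prod fun i k => x i ^ k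

omit [Fintype σ] in
lemma monoEval_add (x : σ → ℂ) (β γ : σ →₀ ℕ) :
    monoEval x (β + γ) = monoEval x β * monoEval x γ :=
  Finsupp.prod_add_index' (fun _ => pow_zero _) (fun _ _ _ => pow_add _ _ _)

/-- The weight `(∏ pᵢ ^ βᵢ)⁻ˢ` of an exponent `β`. -/
noncomputable def weight (s : ℕ) (β : σ →₀ ℕ) : ℝ≥0 := ((godel β : ℝ≥0) ^ s)⁻¹

lemma weight_pos (s : ℕ) (β : σ →₀ ℕ) : 0 < weight s β :=
  inv_pos.2 (pow_pos (Nat.cast_pos.2 (godel_pos β)) _)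

lemma weight_mul (s : ℕ) (β γ : σ →₀ ℕ) : weight s (β + γ) = weight s β * weight s γ := by
  simp [weight, godel_add, mul_pow, mul_comm]

lemma weight_add (s t : ℕ) (β : σ →₀ ℕ) : weight (s + t) β = weight s β * weight t β := by
  simp [weight, pow_add, mul_comm]

lemma weight_le_one (s : ℕ) (β : σ →₀ ℕ) : weight s β ≤ 1 :=
  inv_le_one_of_one_le₀ (one_le_pow₀ (by exact_mod_cast godel_pos β))

/-- The point with coordinates `pᵢ⁻ˢ`. -/
noncomputable def primePoint (s : ℕ) : σ → ℂ := fun i => (((primeLabel i : ℝ≥0) ^ s)⁻¹ : ℝ≥0)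

lemma primePoint_ne_zero (s : ℕ) (i : σ) : primePoint s i ≠ 0 := by
  simp [primePoint, (prime_primeLabel i).ne_zero]

lemma monoEval_primePoint (s : ℕ) (β : σ →₀ ℕ) : monoEval (primePoint s) β = weight s β := by
  simp only [monoEval, primePoint, weight, godel, Finsupp.prod]
  push_cast
  rw [← Finset.prod_pow, ← Finset.prod_inv_distrib]
  exact Finset.prod_congr rfl fun i _ => by rw [inv_pow, ← pow_mul, ← pow_mul, mul_comm]

lemma norm_monoEval_le {s : ℕ} {x : σ → ℂ} (hx : ∀ i, ‖x i‖ ≤ ‖primePoint s i‖) (β : σ →₀ ℕ) :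
    ‖monoEval x β‖ ≤ weight s β := by
  have h : ‖monoEval (primePoint s) β‖ = weight s β := by
    rw [monoEval_primePoint]
    simp
  rw [← h]
  simp only [monoEval, Finsupp.prod, norm_prod, norm_pow]
  gcongr with i
  exact hx i

lemma tendsto_primePoint : Tendsto (primePoint : ℕ → σ → ℂ) atTop (𝓝 0) := by
  refine tendsto_pi_nhds.2 fun i => ?_
  have h := tendsto_pow_atTop_nhds_zero_of_norm_lt_one (x := ((primeLabel i : ℂ))⁻¹) (by
    rw [norm_inv, Complex.norm_natCast]
    exact inv_lt_one_of_one_lt₀ (by exact_mod_cast (prime_primeLabel i).one_lt))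
  refine h.congr fun s => ?_
  simp [primePoint]

lemma eventually_norm_le_primePoint (s : ℕ) :
    ∀ᶠ x : σ → ℂ in 𝓝 0, ∀ i, ‖x i‖ ≤ ‖primePoint s i‖ := by
  refine eventually_all.2 fun i => ?_
  have : Tendsto (fun x : σ → ℂ => ‖x i‖) (𝓝 0) (𝓝 0) := by
    have : Continuous fun x : σ → ℂ => ‖x i‖ := by fun_prop
    simpa using this.tendsto 0
  exact this.eventually_le_const (norm_pos_iff.2 (primePoint_ne_zero s i))

end Godel

section Norm

open MvPowerSeries

variable {σ : Type*} [Fintype σ]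

/-- The weighted `ℓ¹` norm of a power series. -/
noncomputable def wnorm (s : ℕ) (a : MvPowerSeries σ ℂ) : ℝ≥0∞ :=
  ∑' β, ((‖coeff β a‖₊ * weight s β : ℝ≥0) : ℝ≥0∞)

lemma wnorm_anti (a : MvPowerSeries σ ℂ) : Antitone fun s => wnorm s a := by
  intro s t h
  obtain ⟨u, rfl⟩ := Nat.exists_eq_add_of_le h
  refine ENNReal.tsum_le_tsum fun β => ENNReal.coe_le_coe.2 ?_
  rw [weight_add]
  gcongr
  exact mul_le_of_le_one_right' (weight_le_one _ _)

lemma wnorm_add_le (s : ℕ) (a b : MvPowerSeries σ ℂ) : wnorm s (a + b) ≤ wnorm s a + wnorm s b := by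
  rw [wnorm, wnorm, wnorm, ← ENNReal.tsum_add]
  refine ENNReal.tsum_le_tsum fun β => ?_
  rw [← ENNReal.coe_add, ENNReal.coe_le_coe, ← add_mul, map_add]
  gcongr
  exact nnnorm_add_le _ _

lemma wnorm_neg (s : ℕ) (a : MvPowerSeries σ ℂ) : wnorm s (-a) = wnorm s a := by
  simp [wnorm]

lemma wnorm_zero (s : ℕ) : wnorm s (0 : MvPowerSeries σ ℂ) = 0 := by
  simp [wnorm]

lemma wnorm_sum_le {ι : Type*} (s : ℕ) (t : Finset ι) (a : ι → MvPowerSeries σ ℂ) :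
    wnorm s (∑ i ∈ t, a i) ≤ ∑ i ∈ t, wnorm s (a i) :=
  Finset.le_sum_of_subadditive _ (wnorm_zero s).le (wnorm_add_le s) _ _

lemma wnorm_mul_le (s : ℕ) (a b : MvPowerSeries σ ℂ) : wnorm s (a * b) ≤ wnorm s a * wnorm s b := by
  classical
  have h : wnorm s a * wnorm s b = ∑' p : (σ →₀ ℕ) × (σ →₀ ℕ),
      (((‖coeff p.1 a‖₊ * weight s p.1) * (‖coeff p.2 b‖₊ * weight s p.2) : ℝ≥0) : ℝ≥0∞) := by
    simp only [ENNReal.coe_mul (_ * _) (_ * _)]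
    rw [ENNReal.tsum_prod (f := fun p q => ((‖coeff p a‖₊ * weight s p : ℝ≥0) : ℝ≥0∞) *
      ((‖coeff q b‖₊ * weight s q : ℝ≥0) : ℝ≥0∞))]
    simp only [ENNReal.tsum_mul_left, ENNReal.tsum_mul_right, wnorm]
  rw [h, ← Finset.HasAntidiagonal.sigmaAntidiagonalEquivProd.tsum_eq, ENNReal.tsum_sigma']
  refine ENNReal.tsum_le_tsum fun β => ?_
  rw [tsum_fintype, ← ENNReal.ofNNReal_finsetSum, ENNReal.coe_le_coe, coeff_mul,
    ← Finset.sum_coe_sort]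
  refine (mul_le_mul_left (nnnorm_sum_le _ _) _).trans ?_
  rw [Finset.sum_mul]
  refine Finset.sum_le_sum fun p _ => le_of_eq ?_
  have hw : weight s β = weight s p.1.1 * weight s p.1.2 := by
    rw [← weight_mul, Finset.HasAntidiagonal.mem_antidiagonal.1 p.2]
  rw [hw, nnnorm_mul, Finset.HasAntidiagonal.sigmaAntidiagonalEquivProd_apply]
  ring

lemma wnorm_ne_top_iff {s : ℕ} {a : MvPowerSeries σ ℂ} :
    wnorm s a ≠ ∞ ↔ Summable fun β => ‖coeff β a‖ * weight s β := by
  rw [wnorm, ENNReal.tsum_coe_ne_top_iff_summable, ← NNReal.summable_coe]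
  simp

lemma wnorm_ne_top_of_support_finite (s : ℕ) {a : MvPowerSeries σ ℂ}
    (h : {β | coeff β a ≠ 0}.Finite) : wnorm s a ≠ ∞ :=
  wnorm_ne_top_iff.2 (summable_of_hasFiniteSupport (h.subset fun β hβ h0 => hβ (by simp [h0])))

variable (σ) in
/-- The algebra of power series converging near the origin. -/
noncomputable def convergent : Subalgebra ℂ (MvPowerSeries σ ℂ) where
  carrier := {a | ∃ s, wnorm s a ≠ ∞}
  mul_mem' := by
    rintro a b ⟨s, hs⟩ ⟨t, ht⟩
    exact ⟨max s t, ne_top_of_le_ne_top (ENNReal.mul_ne_top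
      (ne_top_of_le_ne_top hs (wnorm_anti a (le_max_left _ _)))
      (ne_top_of_le_ne_top ht (wnorm_anti b (le_max_right _ _)))) (wnorm_mul_le _ _ _)⟩
  add_mem' := by
    rintro a b ⟨s, hs⟩ ⟨t, ht⟩
    exact ⟨max s t, ne_top_of_le_ne_top (ENNReal.add_ne_top.2
      ⟨ne_top_of_le_ne_top hs (wnorm_anti a (le_max_left _ _)),
      ne_top_of_le_ne_top ht (wnorm_anti b (le_max_right _ _))⟩) (wnorm_add_le _ _ _)⟩
  algebraMap_mem' c := by
    classical
    refine ⟨0, wnorm_ne_top_of_support_finite 0 ((Set.finite_singleton 0).subset fun β hβ => ?_)⟩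
    by_contra h
    refine hβ ?_
    rw [MvPowerSeries.algebraMap_apply, coeff_C, if_neg (by simpa using h)]

lemma eventually_wnorm_ne_top {a : MvPowerSeries σ ℂ} (ha : a ∈ convergent σ) :
    ∀ᶠ s in atTop, wnorm s a ≠ ∞ := by
  obtain ⟨s, hs⟩ := ha
  filter_upwards [eventually_ge_atTop s] with t ht
  exact ne_top_of_le_ne_top hs (wnorm_anti a ht)

/-- `γ` is the smallest exponent occurring in `a`, with coefficient `1`. -/
def IsLead (a : MvPowerSeries σ ℂ) (γ : σ →₀ ℕ) : Prop :=
  coeff γ a = 1 ∧ ∀ β, godel β < godel γ → coeff β a = 0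

lemma exists_isLead {a : MvPowerSeries σ ℂ} (ha : a ≠ 0) : ∃ c : ℂ, ∃ γ, c ≠ 0 ∧ coeff γ a ≠ 0 ∧
    IsLead (c • a) γ := by
  have hne : ∃ β, coeff β a ≠ 0 := by
    by_contra! h
    exact ha (MvPowerSeries.ext h)
  obtain ⟨γ, hγ, hmin⟩ := (measure (godel (σ := σ))).wf.has_min {β | coeff β a ≠ 0} hne
  refine ⟨(coeff γ a)⁻¹, γ, inv_ne_zero hγ, hγ, by simpa using inv_mul_cancel₀ hγ,
    fun β hβ => ?_⟩
  have : coeff β a = 0 := by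
    by_contra h
    exact hmin β h hβ
  simp [this]

lemma IsLead.coeff_sub_eq_zero {a : MvPowerSeries σ ℂ} {γ : σ →₀ ℕ} (h : IsLead a γ)
    {β : σ →₀ ℕ} (hβ : godel β ≤ godel γ) : coeff β (a - monomial γ 1) = 0 := by
  classical
  rw [map_sub, coeff_monomial]
  split_ifs with hβγ
  · rw [hβγ, h.1, sub_self]
  · rw [h.2 β (lt_of_le_of_ne hβ fun h' => hβγ (godel_injective h')), sub_self]

lemma monomial_mem_convergent (γ : σ →₀ ℕ) (c : ℂ) : monomial γ c ∈ convergent σ := by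
  classical
  refine ⟨0, wnorm_ne_top_of_support_finite 0 ((Set.finite_singleton γ).subset fun β hβ => ?_)⟩
  by_contra h
  refine hβ ?_
  rw [coeff_monomial, if_neg (by simpa using h)]

lemma IsLead.eventually_wnorm_sub_le {a : MvPowerSeries σ ℂ} {γ : σ →₀ ℕ} (h : IsLead a γ)
    (ha : a ∈ convergent σ) :
    ∀ᶠ s in atTop, 2 * wnorm s (a - monomial γ 1) ≤ weight s γ := by
  obtain ⟨s₀, hs₀⟩ := (convergent σ).sub_mem ha (monomial_mem_convergent γ 1)
  set b := a - monomial γ 1 with hb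
  set ρ : ℝ≥0 := godel γ / (godel γ + 1) with hρ
  have hρ1 : (ρ : ℝ≥0∞) < 1 := by
    rw [ENNReal.coe_lt_one_iff, hρ, div_lt_one (by positivity)]
    exact lt_add_one _
  have hN : (0 : ℝ≥0) < godel γ := Nat.cast_pos.2 (godel_pos γ)
  have hlim : Tendsto (fun t : ℕ => 2 * wnorm s₀ b * (ρ : ℝ≥0∞) ^ t) atTop (𝓝 0) := by
    simpa using ENNReal.Tendsto.const_mul (ENNReal.tendsto_pow_atTop_nhds_zero_of_lt_one hρ1)
      (Or.inr (ENNReal.mul_ne_top ENNReal.ofNat_ne_top hs₀))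
  have hev := hlim.eventually_le_const (ENNReal.coe_pos.2 (weight_pos s₀ γ))
  rw [← map_add_atTop_eq_nat s₀, eventually_map]
  filter_upwards [hev] with t ht
  have hw : wnorm (t + s₀) b ≤ wnorm s₀ b * ((ρ ^ t * weight t γ : ℝ≥0) : ℝ≥0∞) := by
    rw [wnorm, wnorm, ← ENNReal.tsum_mul_right]
    refine ENNReal.tsum_le_tsum fun β => ?_
    rw [← ENNReal.coe_mul, ENNReal.coe_le_coe, add_comm t, weight_add, ← mul_assoc]
    rcases le_or_gt (godel β) (godel γ) with hβ | hβ
    · simp [hb, h.coeff_sub_eq_zero hβ]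
    · gcongr
      rw [weight, weight, hρ, div_pow, div_eq_mul_inv, mul_right_comm,
        mul_inv_cancel₀ (pow_ne_zero _ hN.ne'), one_mul]
      gcongr
      exact_mod_cast hβ
  calc 2 * wnorm (t + s₀) b ≤ 2 * (wnorm s₀ b * ((ρ ^ t * weight t γ : ℝ≥0) : ℝ≥0∞)) := by
        gcongr
    _ = 2 * wnorm s₀ b * (ρ : ℝ≥0∞) ^ t * weight t γ := by
        push_cast
        ring
    _ ≤ weight s₀ γ * weight t γ := by gcongr
    _ = weight (t + s₀) γ := by rw [add_comm t, weight_add, ENNReal.coe_mul]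

end Norm

section Division

open MvPowerSeries

variable {σ : Type*} [Fintype σ]

/-- The part of a power series with exponents of Gödel number at most `K`. -/
noncomputable def truncGodel (K : ℕ) (a : MvPowerSeries σ ℂ) : MvPowerSeries σ ℂ :=
  fun β => if godel β ≤ K then coeff β a else 0

lemma coeff_truncGodel (K : ℕ) (a : MvPowerSeries σ ℂ) (β : σ →₀ ℕ) :
    coeff β (truncGodel K a) = if godel β ≤ K then coeff β a else 0 := rfl

lemma wnorm_truncGodel_ne_top (s K : ℕ) (a : MvPowerSeries σ ℂ) :
    wnorm s (truncGodel K a) ≠ ∞ := by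
  refine wnorm_ne_top_of_support_finite s ((finite_godel_le K).subset fun β hβ => ?_)
  by_contra h
  exact hβ (if_neg h)

/-- A map `T` whose output coefficients depend only on strictly smaller input coefficients, and
which is a contraction for the weighted norm, can be inverted as a perturbation of the identity. -/
lemma exists_add_apply_eq (s : ℕ) (T : MvPowerSeries σ ℂ → MvPowerSeries σ ℂ)
    (hT : ∀ γ a b, (∀ β, godel β < godel γ → coeff β a = coeff β b) →
      coeff γ (T a) = coeff γ (T b))
    (hTs : ∀ a, 2 * wnorm s (T a) ≤ wnorm s a) {F : MvPowerSeries σ ℂ} (hF : wnorm s F ≠ ∞) :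
    ∃ H, H + T H = F ∧ wnorm s H ≠ ∞ := by
  let step (γ : σ →₀ ℕ) (ih : ∀ β, godel β < godel γ → ℂ) : ℂ :=
    coeff γ F - coeff γ (T fun β => if h : godel β < godel γ then ih β h else 0)
  let H : MvPowerSeries σ ℂ := (measure (godel (σ := σ))).wf.fix step
  have hH (γ) : coeff γ H = coeff γ F - coeff γ (T H) := by
    have h1 : coeff γ H = step γ fun β _ => coeff β H :=
      (measure (godel (σ := σ))).wf.fix_eq step γ
    exact h1.trans (congrArg (coeff γ F - ·) (hT γ _ _ fun β hβ => dif_pos hβ))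
  refine ⟨H, MvPowerSeries.ext fun γ => by rw [map_add, hH, sub_add_cancel], ?_⟩
  have htr (K : ℕ) : wnorm s (truncGodel K H) ≤ 2 * wnorm s F := by
    have h1 : wnorm s (truncGodel K H) ≤ wnorm s (F + -T (truncGodel K H)) := by
      refine ENNReal.tsum_le_tsum fun γ => ENNReal.coe_le_coe.2 ?_
      rw [coeff_truncGodel]
      split_ifs with hγ
      · rw [hH, hT γ H (truncGodel K H) fun β hβ => by
          rw [coeff_truncGodel, if_pos (hβ.le.trans hγ)], map_add, map_neg, sub_eq_add_neg]
      · simp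
    have h2 : 2 * wnorm s (truncGodel K H) ≤ 2 * wnorm s F + wnorm s (truncGodel K H) := by
      calc 2 * wnorm s (truncGodel K H)
          ≤ 2 * (wnorm s F + wnorm s (T (truncGodel K H))) := by
            gcongr
            exact h1.trans ((wnorm_add_le _ _ _).trans_eq (by rw [wnorm_neg]))
        _ ≤ _ := by
            rw [mul_add]
            gcongr
            exact hTs _
    rw [two_mul (wnorm s (truncGodel K H))] at h2
    exact (ENNReal.add_le_add_iff_right (wnorm_truncGodel_ne_top s K H)).1 h2
  refine ne_top_of_le_ne_top (ENNReal.mul_ne_top ENNReal.ofNat_ne_top hF) (b := 2 * wnorm s F) ?_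
  rw [wnorm, ENNReal.tsum_eq_iSup_sum]
  refine iSup_le fun t => ?_
  refine le_trans ?_ (htr (t.sup godel))
  refine le_trans (Finset.sum_le_sum fun β hβ => ?_) (ENNReal.sum_le_tsum t)
  rw [coeff_truncGodel, if_pos (Finset.le_sup (f := godel) hβ)]

/-- **Grauert–Hironaka division** by series with prescribed leading exponents. -/
lemma exists_division (s : ℕ) (M : Finset (σ →₀ ℕ)) (g : (σ →₀ ℕ) → MvPowerSeries σ ℂ)
    (hlead : ∀ α ∈ M, IsLead (g α) α)
    (hs : ∀ α ∈ M, 2 * wnorm s (g α - monomial α 1) ≤ weight s α)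
    {F : MvPowerSeries σ ℂ} (hF : wnorm s F ≠ ∞) :
    ∃ (q : (σ →₀ ℕ) → MvPowerSeries σ ℂ) (r : MvPowerSeries σ ℂ),
      (∀ α ∈ M, wnorm s (q α) ≠ ∞) ∧
      (∀ β, (∃ α ∈ M, α ≤ β) → coeff β r = 0) ∧ F = ∑ α ∈ M, q α * g α + r := by
  classical
  have hsel (β : σ →₀ ℕ) : ∃ α, (∃ α' ∈ M, α' ≤ β) → α ∈ M ∧ α ≤ β := by
    by_cases h : ∃ α' ∈ M, α' ≤ β
    · exact ⟨h.choose, fun _ => h.choose_spec⟩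
    · exact ⟨0, fun h' => (h h').elim⟩
  choose m hm using hsel
  let q (H : MvPowerSeries σ ℂ) (α : σ →₀ ℕ) : MvPowerSeries σ ℂ :=
    fun β => if m (β + α) = α then coeff (β + α) H else 0
  let r (H : MvPowerSeries σ ℂ) : MvPowerSeries σ ℂ :=
    fun β => if ∃ α ∈ M, α ≤ β then 0 else coeff β H
  have hq (H α β) : coeff β (q H α) = if m (β + α) = α then coeff (β + α) H else 0 := rfl
  have hr (H β) : coeff β (r H) = if ∃ α ∈ M, α ≤ β then 0 else coeff β H := rfl
  have hdecomp (H) : ∑ α ∈ M, q H α * monomial α 1 + r H = H := by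
    ext γ
    have h1 (α : σ →₀ ℕ) : coeff γ (q H α * monomial α 1) =
        if m γ = α ∧ α ≤ γ then coeff γ H else 0 := by
      rw [coeff_mul_monomial]
      by_cases hα : α ≤ γ
      · simp [hα, hq, tsub_add_cancel_of_le hα]
      · simp [hα]
    rw [map_add, map_sum, Finset.sum_congr rfl fun α _ => h1 α, hr]
    by_cases hγ : ∃ α ∈ M, α ≤ γ
    · rw [if_pos hγ, add_zero, Finset.sum_eq_single_of_mem (m γ) (hm γ hγ).1
        fun α _ hα => if_neg fun h => hα h.1.symm, if_pos ⟨rfl, (hm γ hγ).2⟩]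
    · rw [if_neg hγ, Finset.sum_eq_zero fun α hα => if_neg fun h => hγ ⟨α, hα, h.2⟩, zero_add]
  have hnorm (H) : ∑ α ∈ M, wnorm s (q H α) * weight s α ≤ wnorm s H := by
    calc ∑ α ∈ M, wnorm s (q H α) * weight s α
        ≤ ∑ α ∈ M, ∑' γ, ((if m γ = α then ‖coeff γ H‖₊ * weight s γ else 0 : ℝ≥0) : ℝ≥0∞) := by
          refine Finset.sum_le_sum fun α _ => ?_
          refine le_trans (le_of_eq ?_)
            (ENNReal.tsum_comp_le_tsum_of_injective (add_left_injective α) _)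
          rw [wnorm, ← ENNReal.tsum_mul_right]
          refine tsum_congr fun β => ?_
          rw [← ENNReal.coe_mul, hq, weight_mul]
          split_ifs <;> simp [mul_assoc]
      _ = ∑' γ, ∑ α ∈ M, ((if m γ = α then ‖coeff γ H‖₊ * weight s γ else 0 : ℝ≥0) : ℝ≥0∞) :=
          (Summable.tsum_finsetSum fun _ _ => ENNReal.summable).symm
      _ ≤ wnorm s H := by
          refine ENNReal.tsum_le_tsum fun γ => ?_
          rw [← ENNReal.ofNNReal_finsetSum, ENNReal.coe_le_coe, Finset.sum_ite_eq]
          split_ifs <;> simp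
  let T (H : MvPowerSeries σ ℂ) : MvPowerSeries σ ℂ := ∑ α ∈ M, q H α * (g α - monomial α 1)
  obtain ⟨H, hHF, hH⟩ := exists_add_apply_eq s T (fun γ a b hab => by
      simp only [T, map_sum]
      refine Finset.sum_congr rfl fun α hα => ?_
      rw [coeff_mul, coeff_mul]
      refine Finset.sum_congr rfl fun p hp => ?_
      rcases le_or_gt (godel p.2) (godel α) with h | h
      · rw [(hlead α hα).coeff_sub_eq_zero h, mul_zero, mul_zero]
      · rw [hq, hq, hab _ (godel_lt_of_add_eq (Finset.HasAntidiagonal.mem_antidiagonal.1 hp) h)])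
    (fun a => by
      calc 2 * wnorm s (T a) ≤ 2 * ∑ α ∈ M, wnorm s (q a α) * wnorm s (g α - monomial α 1) := by
            gcongr
            exact (wnorm_sum_le _ _ _).trans (Finset.sum_le_sum fun _ _ => wnorm_mul_le _ _ _)
        _ = ∑ α ∈ M, wnorm s (q a α) * (2 * wnorm s (g α - monomial α 1)) := by
            rw [Finset.mul_sum]
            exact Finset.sum_congr rfl fun _ _ => by ring
        _ ≤ ∑ α ∈ M, wnorm s (q a α) * weight s α :=
            Finset.sum_le_sum fun α hα => mul_le_mul_right (hs α hα) _
        _ ≤ _ := hnorm a) hF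
  refine ⟨q H, r H, fun α hα htop => hH (top_unique ?_), fun β hβ => by rw [hr, if_pos hβ], ?_⟩
  · refine le_trans (le_of_eq ?_) ((Finset.single_le_sum (fun _ _ => zero_le) hα).trans (hnorm H))
    rw [htop, ENNReal.top_mul (ENNReal.coe_pos.2 (weight_pos s α)).ne']
  · rw [← hHF]
    nth_rewrite 1 [← hdecomp H]
    simp only [T, mul_sub, Finset.sum_sub_distrib]
    abel

/-- Dickson's lemma. -/
lemma exists_finset_forall_exists_le (E : Set (σ →₀ ℕ)) :
    ∃ M : Finset (σ →₀ ℕ), (∀ α ∈ M, α ∈ E) ∧ ∀ β ∈ E, ∃ α ∈ M, α ≤ β := by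
  have hfin : {x | Minimal (· ∈ E) x}.Finite :=
    WellQuasiOrderedLE.finite_of_isAntichain (setOfPred_minimal_antichain _)
  refine ⟨hfin.toFinset, fun α hα => (hfin.mem_toFinset.1 hα).1, fun β hβ => ?_⟩
  obtain ⟨α, hαβ, hα⟩ := exists_minimal_le_of_wellFoundedLT (· ∈ E) β hβ
  exact ⟨α, hfin.mem_toFinset.2 hα, hαβ⟩

/-- Every ideal of the ring of convergent power series is closed in the topology of coefficientwise
convergence. -/
theorem mem_ideal_of_forall_approx (J : Ideal (convergent σ)) (F : convergent σ)
    (h : ∀ K, ∃ j ∈ J, ∀ β, godel β ≤ K →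
      coeff β (F : MvPowerSeries σ ℂ) = coeff β (j : MvPowerSeries σ ℂ)) : F ∈ J := by
  obtain ⟨M, hME, hM⟩ := exists_finset_forall_exists_le
    {γ | ∃ g ∈ J, IsLead (g : MvPowerSeries σ ℂ) γ}
  have hg (α) : ∃ g ∈ J, α ∈ M → IsLead (g : MvPowerSeries σ ℂ) α := by
    by_cases hα : α ∈ M
    · obtain ⟨g, hgJ, hg⟩ := hME α hα
      exact ⟨g, hgJ, fun _ => hg⟩
    · exact ⟨0, J.zero_mem, fun h => (hα h).elim⟩
  choose g hgJ hg using hg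
  obtain ⟨s, hs, hsF⟩ := (((Finset.eventually_all M).2 fun α hα =>
    (hg α hα).eventually_wnorm_sub_le (g α).2).and (eventually_wnorm_ne_top F.2)).exists
  obtain ⟨q, r, hq, hr, hF⟩ := exists_division s M (fun α => g α) hg hs hsF
  let Q : convergent σ := ∑ α ∈ M.attach, ⟨q α, s, hq α α.2⟩ * g α
  have hQ : (Q : MvPowerSeries σ ℂ) = ∑ α ∈ M, q α * g α := by
    rw [← Finset.sum_attach M]
    simp [Q]
  have hQJ : Q ∈ J := J.sum_mem fun α _ => J.mul_mem_left _ (hgJ α)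
  have hr' : r = ((F - Q : convergent σ) : MvPowerSeries σ ℂ) := by
    rw [AddSubgroupClass.coe_sub, hQ, hF, add_sub_cancel_left]
  suffices hr0 : r = 0 by
    rw [hr', ZeroMemClass.coe_eq_zero, sub_eq_zero] at hr0
    exact hr0 ▸ hQJ
  by_contra hne
  obtain ⟨c, γ, -, hγ, hlead⟩ := exists_isLead hne
  obtain ⟨j, hj, hjF⟩ := h (godel γ)
  have hco (β) (hβ : godel β ≤ godel γ) :
      coeff β ((c • (j - Q) : convergent σ) : MvPowerSeries σ ℂ) = coeff β (c • r) := by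
    rw [hr']
    simp [hjF β hβ]
  refine hγ (hr γ (hM γ ⟨c • (j - Q), J.smul_of_tower_mem c (J.sub_mem hj hQJ), ?_⟩))
  exact ⟨(hco γ le_rfl).trans hlead.1, fun β hβ => (hco β hβ.le).trans (hlead.2 β hβ)⟩

end Division

section Taylor

open MvPowerSeries

variable {σ : Type*} [Fintype σ]

/-- The power series `a` converges to `f` in a neighborhood of the origin. -/
def HasTaylor (f : (σ → ℂ) → ℂ) (a : MvPowerSeries σ ℂ) : Prop :=
  ∀ᶠ x in 𝓝 0, HasSum (fun β => coeff β a * monoEval x β) (f x)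

omit [Fintype σ] in
lemma HasTaylor.congr {f g : (σ → ℂ) → ℂ} {a : MvPowerSeries σ ℂ} (h : HasTaylor f a)
    (hfg : f =ᶠ[𝓝 0] g) : HasTaylor g a := by
  filter_upwards [h, hfg] with x hx hx'
  rwa [← hx']

lemma wnorm_ne_top_of_summable {s : ℕ} {a : MvPowerSeries σ ℂ}
    (h : Summable fun β => coeff β a * monoEval (primePoint s) β) : wnorm s a ≠ ∞ := by
  refine wnorm_ne_top_iff.2 (h.norm.congr fun β => ?_)
  rw [norm_mul, monoEval_primePoint]
  simp

lemma summable_of_wnorm_ne_top {s : ℕ} {a : MvPowerSeries σ ℂ} (h : wnorm s a ≠ ∞) {x : σ → ℂ}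
    (hx : ∀ i, ‖x i‖ ≤ ‖primePoint s i‖) : Summable fun β => coeff β a * monoEval x β := by
  refine Summable.of_norm_bounded (wnorm_ne_top_iff.1 h) fun β => ?_
  rw [norm_mul]
  gcongr
  exact norm_monoEval_le hx β

lemma HasTaylor.mem_convergent {f : (σ → ℂ) → ℂ} {a : MvPowerSeries σ ℂ} (h : HasTaylor f a) :
    a ∈ convergent σ :=
  let ⟨s, hs⟩ := (tendsto_primePoint.eventually h).exists
  ⟨s, wnorm_ne_top_of_summable hs.summable⟩

lemma exists_hasTaylor {a : MvPowerSeries σ ℂ} (ha : a ∈ convergent σ) : ∃ f, HasTaylor f a := by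
  obtain ⟨s, hs⟩ := ha
  refine ⟨fun x => ∑' β, coeff β a * monoEval x β, ?_⟩
  filter_upwards [eventually_norm_le_primePoint s] with x hx
  exact (summable_of_wnorm_ne_top hs hx).hasSum

omit [Fintype σ] in
lemma HasTaylor.sub {f g : (σ → ℂ) → ℂ} {a b : MvPowerSeries σ ℂ} (hf : HasTaylor f a)
    (hg : HasTaylor g b) : HasTaylor (f - g) (a - b) := by
  filter_upwards [hf, hg] with x hx hx'
  exact (hx.sub hx').congr_fun (fun β => by simp [sub_mul])

omit [Fintype σ] in
lemma HasTaylor.const_smul {f : (σ → ℂ) → ℂ} {a : MvPowerSeries σ ℂ} (hf : HasTaylor f a) (c : ℂ) :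
    HasTaylor (c • f) (c • a) := by
  filter_upwards [hf] with x hx
  exact (hx.mul_left c).congr_fun (fun β => by simp [mul_assoc])

omit [Fintype σ] in
lemma HasTaylor.sum {ι : Type*} {t : Finset ι} {f : ι → (σ → ℂ) → ℂ} {a : ι → MvPowerSeries σ ℂ}
    (h : ∀ i ∈ t, HasTaylor (f i) (a i)) :
    HasTaylor (fun x => ∑ i ∈ t, f i x) (∑ i ∈ t, a i) := by
  filter_upwards [(Finset.eventually_all t).2 h] with x hx
  exact (hasSum_sum hx).congr_fun (fun β => by simp [Finset.sum_mul])

lemma hasSum_mul_antidiagonal {A : Type*} [AddCommMonoid A] [Finset.HasAntidiagonal A]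
    {u v : A → ℂ} {y z : ℂ} (hu : HasSum u y) (hv : HasSum v z) :
    HasSum (fun β => ∑ p ∈ Finset.HasAntidiagonal.antidiagonal β, u p.1 * v p.2) (y * z) := by
  have hsum : Summable fun p : A × A => u p.1 * v p.2 :=
    summable_mul_of_summable_norm hu.summable.norm hv.summable.norm
  rw [← hu.tsum_eq, ← hv.tsum_eq,
    hu.summable.tsum_mul_tsum_eq_tsum_sum_antidiagonal hv.summable hsum]
  exact (summable_sum_mul_antidiagonal_of_summable_mul hsum).hasSum

omit [Fintype σ] in
lemma HasTaylor.mul {f g : (σ → ℂ) → ℂ} {a b : MvPowerSeries σ ℂ} (hf : HasTaylor f a)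
    (hg : HasTaylor g b) : HasTaylor (f * g) (a * b) := by
  classical
  filter_upwards [hf, hg] with x hx hx'
  have h := hasSum_mul_antidiagonal hx hx'
  refine h.congr_fun fun β => ?_
  rw [coeff_mul, Finset.sum_mul]
  refine Finset.sum_congr rfl fun p hp => ?_
  rw [← Finset.HasAntidiagonal.mem_antidiagonal.1 hp, monoEval_add]
  ring

lemma HasTaylor.eq_zero {a : MvPowerSeries σ ℂ} (h : HasTaylor 0 a) : a = 0 := by
  classical
  by_contra hne
  obtain ⟨c, γ, -, -, hlead⟩ := exists_isLead hne
  have hc : HasTaylor 0 (c • a) := by simpa using h.const_smul c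
  obtain ⟨s, hs, hs', hs''⟩ := ((hlead.eventually_wnorm_sub_le hc.mem_convergent).and
    ((tendsto_primePoint.eventually hc).and (eventually_wnorm_ne_top
      ((convergent σ).sub_mem hc.mem_convergent (monomial_mem_convergent γ 1))))).exists
  set b := c • a - monomial γ 1 with hb
  have hsum : HasSum (fun β => coeff β b * monoEval (primePoint s) β) (-(weight s γ : ℂ)) := by
    have h1 := hasSum_ite_eq γ (weight s γ : ℂ)
    have h2 := hs'.sub h1
    rw [Pi.zero_apply, zero_sub] at h2
    refine h2.congr_fun fun β => ?_
    rw [hb, map_sub, coeff_monomial, sub_mul, monoEval_primePoint]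
    split_ifs with hβ <;> simp [hβ]
  have hle : (weight s γ : ℝ) ≤ ∑' β, ‖coeff β b‖ * weight s β := by
    have := norm_tsum_le_tsum_norm hsum.summable.norm
    rw [hsum.tsum_eq] at this
    simpa [monoEval_primePoint] using this
  have hw : wnorm s b = ENNReal.ofReal (∑' β, ‖coeff β b‖ * weight s β) := by
    rw [ENNReal.ofReal_tsum_of_nonneg (fun _ => by positivity) (wnorm_ne_top_iff.1 hs''), wnorm]
    refine tsum_congr fun β => ?_
    rw [ENNReal.ofReal, Real.toNNReal_mul (norm_nonneg _), norm_toNNReal, Real.toNNReal_coe]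
  have hle' : (weight s γ : ℝ≥0∞) ≤ wnorm s b := by
    rw [hw, ← ENNReal.ofReal_coe_nnreal]
    exact ENNReal.ofReal_le_ofReal hle
  have hpos : (0 : ℝ≥0∞) < wnorm s b := (ENNReal.coe_pos.2 (weight_pos s γ)).trans_le hle'
  have hcon : wnorm s b + wnorm s b ≤ 0 + wnorm s b := by
    rw [← two_mul, zero_add]
    exact hs.trans hle'
  exact hpos.not_ge ((ENNReal.add_le_add_iff_right hs'').1 hcon)

lemma HasTaylor.unique {f : (σ → ℂ) → ℂ} {a b : MvPowerSeries σ ℂ} (ha : HasTaylor f a)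
    (hb : HasTaylor f b) : a = b :=
  sub_eq_zero.1 (HasTaylor.eq_zero (by simpa using ha.sub hb))

end Taylor

section Words

open MvPowerSeries

variable {σ : Type*} [Fintype σ]

/-- The exponent of the monomial obtained by multiplying the letters of a word. -/
noncomputable def content (c : Σ n, Fin n → σ) : σ →₀ ℕ := ∑ i, Finsupp.single (c.2 i) 1

omit [Fintype σ] in
lemma monoEval_content (x : σ → ℂ) (c : Σ n, Fin n → σ) :
    monoEval x (content c) = ∏ i, x (c.2 i) := by
  rw [monoEval, content, ← Finsupp.prod_finsetSum_index (fun _ => pow_zero _)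
    (fun _ _ _ => pow_add _ _ _)]
  simp

omit [Fintype σ] in
lemma content_surjective : Function.Surjective (content (σ := σ)) := by
  intro β
  induction β using Finsupp.induction_linear with
  | zero => exact ⟨⟨0, Fin.elim0⟩, by simp [content]⟩
  | add f g hf hg =>
    obtain ⟨⟨n, v⟩, rfl⟩ := hf
    obtain ⟨⟨m, w⟩, rfl⟩ := hg
    exact ⟨⟨n + m, Fin.append v w⟩, by simp [content, Fin.sum_univ_add]⟩
  | single i k => exact ⟨⟨k, fun _ => i⟩, by simp [content]⟩

lemma exists_hasTaylor_of_analyticAt {f : (σ → ℂ) → ℂ} (hf : AnalyticAt ℂ f 0) :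
    ∃ a, HasTaylor f a := by
  classical
  obtain ⟨p, R, hp⟩ := hf
  let P (c : Σ n, Fin n → σ) : ℂ := p c.1 fun i => Pi.single (c.2 i) 1
  obtain ⟨ρ, hρ0, hρR⟩ := ENNReal.lt_iff_exists_nnreal_btwn.1 hp.r_pos
  have hρ0' : 0 < ρ := ENNReal.coe_pos.1 hρ0
  let N : ℝ≥0 := Fintype.card σ + 1
  have hN : 0 < N := by positivity
  refine ⟨fun β => ∑' c : content ⁻¹' {β}, P c, ?_⟩
  have hball : ∀ᶠ x : σ → ℂ in 𝓝 0, ‖x‖ < ρ / N := by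
    have := Metric.ball_mem_nhds (0 : σ → ℂ) (NNReal.coe_pos.2 (div_pos hρ0' hN))
    filter_upwards [this] with x hx
    simpa using hx
  filter_upwards [hball] with x hx
  have hexp (n : ℕ) : p n (fun _ => x) = ∑ w : Fin n → σ, P ⟨n, w⟩ * ∏ i, x (w i) := by
    have hx' : x = ∑ j, x j • (Pi.single j (1 : ℂ) : σ → ℂ) := by
      ext k
      simp [Finset.sum_apply, Pi.single_apply]
    have h1 := (p n).toMultilinearMap.map_sum (α := fun _ => σ)
      (fun _ j => x j • (Pi.single j (1 : ℂ) : σ → ℂ))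
    rw [← hx'] at h1
    refine h1.trans (Finset.sum_congr rfl fun w _ => ?_)
    rw [MultilinearMap.map_smul_univ, smul_eq_mul, mul_comm]
    rfl
  have hx1 : x ∈ Metric.eball (0 : σ → ℂ) R := by
    rw [Metric.mem_eball, edist_zero_right]
    refine lt_trans ?_ hρR
    rw [enorm_eq_nnnorm, ENNReal.coe_lt_coe, ← NNReal.coe_lt_coe, coe_nnnorm]
    refine hx.trans_le (div_le_self ρ.2 ?_)
    simp [N]
  have hPn (c : Σ n, Fin n → σ) : ‖P c‖ ≤ ‖p c.1‖ := by
    refine ((p c.1).le_opNorm _).trans_eq ?_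
    rw [Finset.prod_eq_one fun i _ => by rw [Pi.norm_single, norm_one], mul_one]
  have hsumm : Summable fun c : Σ n, Fin n → σ => P c * ∏ i, x (c.2 i) := by
    refine Summable.of_norm ?_
    rw [summable_sigma_of_nonneg fun _ => norm_nonneg _]
    refine ⟨fun n => Summable.of_finite, ?_⟩
    refine Summable.of_nonneg_of_le (fun n => tsum_nonneg fun _ => norm_nonneg _) (fun n => ?_)
      (p.summable_norm_mul_pow (hρR.trans_le hp.r_le))
    rw [tsum_fintype]
    calc ∑ w : Fin n → σ, ‖P ⟨n, w⟩ * ∏ i, x (w i)‖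
        ≤ ∑ _w : Fin n → σ, ‖p n‖ * (ρ / N) ^ n := by
          refine Finset.sum_le_sum fun w _ => ?_
          rw [norm_mul, norm_prod]
          gcongr
          · exact hPn ⟨n, w⟩
          · refine (Finset.prod_le_prod (fun _ _ => norm_nonneg _) fun i _ => ?_).trans_eq
              (Fin.prod_const n _)
            exact (norm_le_pi_norm x _).trans hx.le
      _ = ‖p n‖ * (Fintype.card σ * (ρ / N)) ^ n := by
          simp [mul_pow]
          ring
      _ ≤ ‖p n‖ * ρ ^ n := by
          gcongr
          rw [mul_div_left_comm]
          refine mul_le_of_le_one_right ρ.2 (div_le_one_of_le₀ ?_ N.2)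
          simp [N]
  have htot : HasSum (fun c : Σ n, Fin n → σ => P c * ∏ i, x (c.2 i)) (f x) := by
    have h1 := hsumm.hasSum.sigma fun n => hasSum_fintype _
    have h2 := hp.hasSum hx1
    simp only [hexp, zero_add] at h2
    rw [← h1.unique h2]
    exact hsumm.hasSum
  rw [← (Equiv.sigmaFiberEquiv content).hasSum_iff] at htot
  refine htot.sigma fun β => ?_
  have hfib := (htot.summable.sigma_factor β).hasSum
  have hconst (c : content ⁻¹' {β}) :
      ((fun c => P c * ∏ i, x (c.2 i)) ∘ Equiv.sigmaFiberEquiv content) ⟨β, c⟩ =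
        P c * monoEval x β := by
    have hc : monoEval x β = ∏ i, x (c.1.2 i) :=
      (congrArg (monoEval x) c.2).symm.trans (monoEval_content x c)
    rw [hc]
    rfl
  have hval : coeff β (fun β => ∑' c : content ⁻¹' {β}, P c : MvPowerSeries σ ℂ) * monoEval x β =
      ∑' c : content ⁻¹' {β},
        ((fun c => P c * ∏ i, x (c.2 i)) ∘ Equiv.sigmaFiberEquiv content) ⟨β, c⟩ := by
    rw [tsum_congr hconst, tsum_mul_right]
    rfl
  rw [hval]
  exact hfib

lemma HasTaylor.analyticAt {f : (σ → ℂ) → ℂ} {a : MvPowerSeries σ ℂ} (h : HasTaylor f a) :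
    AnalyticAt ℂ f 0 := by
  classical
  obtain ⟨ε, hε, hball⟩ := Metric.eventually_nhds_iff.1 h
  let ρ : ℝ≥0 := ⟨ε / 2, by positivity⟩
  have hρ : (ρ : ℝ) = ε / 2 := rfl
  let word := Function.surjInv (content_surjective (σ := σ))
  have hword : Function.Injective word := Function.injective_surjInv _
  have hcontent (β) : content (word β) = β := Function.surjInv_eq _ β
  let b : (Σ n, Fin n → σ) → ℂ := Function.extend word (fun β => coeff β a) 0
  have hb (β) : b (word β) = coeff β a := hword.extend_apply _ _ β
  have hb0 (c) (hc : c ∉ Set.range word) : b c = 0 :=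
    Function.extend_apply' _ _ _ fun ⟨β, hβ⟩ => hc ⟨β, hβ⟩
  let p : FormalMultilinearSeries ℂ (σ → ℂ) ℂ := fun n => ∑ w : Fin n → σ, b ⟨n, w⟩ •
    (ContinuousMultilinearMap.mkPiAlgebra ℂ (Fin n) ℂ).compContinuousLinearMap
      fun i => ContinuousLinearMap.proj (w i)
  have hp (n : ℕ) (x : σ → ℂ) : p n (fun _ => x) = ∑ w : Fin n → σ, b ⟨n, w⟩ * ∏ i, x (w i) := by
    simp [p]
  have hpn (n : ℕ) : ‖p n‖ ≤ ∑ w : Fin n → σ, ‖b ⟨n, w⟩‖ := by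
    refine (norm_sum_le _ _).trans (Finset.sum_le_sum fun w _ => ?_)
    rw [norm_smul]
    refine mul_le_of_le_one_right (norm_nonneg _) ?_
    refine ContinuousMultilinearMap.opNorm_le_bound zero_le_one fun m => ?_
    rw [one_mul]
    simp only [ContinuousMultilinearMap.compContinuousLinearMap_apply,
      ContinuousMultilinearMap.mkPiAlgebra_apply, ContinuousLinearMap.proj_apply, norm_prod]
    gcongr with i
    exact norm_le_pi_norm (m i) _
  have hwords {x : σ → ℂ} {y : ℂ} (hx : HasSum (fun β => coeff β a * monoEval x β) y) :
      HasSum (fun c : Σ n, Fin n → σ => b c * ∏ i, x (c.2 i)) y := by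
    refine (hword.hasSum_iff fun c hc => by rw [hb0 c hc, zero_mul]).1 ?_
    refine hx.congr_fun fun β => ?_
    rw [Function.comp_apply, hb, ← monoEval_content, hcontent]
  have hsumm : Summable fun n => ‖p n‖ * (ρ : ℝ) ^ n := by
    have h1 : dist (fun _ : σ => ((ρ : ℝ) : ℂ)) 0 < ε := by
      rw [dist_zero_right]
      refine (pi_norm_const_le _).trans_lt ?_
      simpa [hρ, abs_of_pos hε] using hε
    have h2 := (hwords (hball h1)).summable.norm.sigma
    refine Summable.of_nonneg_of_le (fun n => by positivity) (fun n => ?_) h2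
    rw [tsum_fintype]
    refine (mul_le_mul_of_nonneg_right (hpn n) (by positivity)).trans_eq ?_
    rw [Finset.sum_mul]
    refine Finset.sum_congr rfl fun w _ => ?_
    simp
  refine HasFPowerSeriesOnBall.analyticAt (p := p) (r := ρ) ⟨p.le_radius_of_summable hsumm, ?_, ?_⟩
  · exact ENNReal.coe_pos.2 (half_pos hε)
  · intro y hy
    have hy' : dist y 0 < ε := by
      rw [Metric.mem_eball, edist_nndist, ENNReal.coe_lt_coe, ← NNReal.coe_lt_coe, coe_nndist] at hy
      linarith
    have h1 := (hwords (hball hy')).sigma fun n => hasSum_fintype _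
    rw [zero_add]
    exact h1.congr_fun fun n => hp n y

end Words

section Slices

open MvPowerSeries

variable {ι κ : Type*} [Fintype ι] [Fintype κ]

omit [Fintype ι] [Fintype κ] in
/-- The exponent on `ι ⊕ κ` with components `α` and `γ`. -/
noncomputable def joinExp : (ι →₀ ℕ) × (κ →₀ ℕ) ≃+ (ι ⊕ κ →₀ ℕ) :=
  Finsupp.sumFinsuppAddEquivProdFinsupp.symm

lemma monoEval_joinExp (x : ι → ℂ) (s : κ → ℂ) (p : (ι →₀ ℕ) × (κ →₀ ℕ)) :
    monoEval (Sum.elim x s) (joinExp p) = monoEval x p.1 * monoEval s p.2 := by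
  simp only [monoEval, Finsupp.prod_fintype _ _ fun _ => pow_zero _, Fintype.prod_sum_type]
  rfl

/-- The coefficients of a power series in two groups of variables, as a series in the second group
with coefficients series in the first group. -/
noncomputable def column (A : MvPowerSeries (ι ⊕ κ) ℂ) (γ : κ →₀ ℕ) : MvPowerSeries ι ℂ :=
  fun α => coeff (joinExp (α, γ)) A

omit [Fintype ι] [Fintype κ] in
lemma coeff_column (A : MvPowerSeries (ι ⊕ κ) ℂ) (γ : κ →₀ ℕ) (α : ι →₀ ℕ) :
    coeff α (column A γ) = coeff (joinExp (α, γ)) A := rfl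

lemma summable_of_hasSum_prod_mul {A B : Type*} {u : A → B → ℂ} {v : A → ℂ} {y : ℂ}
    (h : HasSum (fun p : A × B => u p.1 p.2 * v p.1) y) {α : A} (hα : v α ≠ 0) :
    Summable (u α) :=
  (summable_mul_right_iff hα).1 (h.summable.prod_factor α)

lemma hasSum_tsum_mul {A B : Type*} {u : A → B → ℂ} {v : A → ℂ} {y : ℂ}
    (h : HasSum (fun p : A × B => u p.1 p.2 * v p.1) y) (hu : ∀ α, Summable (u α)) :
    HasSum (fun α => (∑' γ, u α γ) * v α) y :=
  h.prod_fiberwise fun α => (hu α).hasSum.mul_right (v α)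

lemma HasTaylor.eventually_slice {F : (ι ⊕ κ → ℂ) → ℂ} {A : MvPowerSeries (ι ⊕ κ) ℂ}
    (h : HasTaylor F A) : ∀ᶠ s in 𝓝 (0 : κ → ℂ), ∃ c : MvPowerSeries ι ℂ,
      HasTaylor (fun x => F (Sum.elim x s)) c ∧
      ∀ α, HasSum (fun γ => coeff α (column A γ) * monoEval s γ) (coeff α c) := by
  have hcont : Continuous fun p : (ι → ℂ) × (κ → ℂ) => (Sum.elim p.1 p.2 : ι ⊕ κ → ℂ) := by
    refine continuous_pi fun i => ?_
    rcases i with i | i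
    · exact (continuous_apply i).comp continuous_fst
    · exact (continuous_apply i).comp continuous_snd
  have hlim : Tendsto (fun p : (ι → ℂ) × (κ → ℂ) => (Sum.elim p.1 p.2 : ι ⊕ κ → ℂ))
      (𝓝 0 ×ˢ 𝓝 0) (𝓝 0) := by
    rw [← nhds_prod_eq]
    convert hcont.tendsto (0, 0) using 2
    ext i
    rcases i with i | i <;> rfl
  obtain ⟨px, hpx, ps, hps, hall⟩ := eventually_prod_iff.1 (hlim.eventually h)
  have hjoin {x : ι → ℂ} {s : κ → ℂ} (hx : px x) (hs : ps s) :
      HasSum (fun p : (ι →₀ ℕ) × (κ →₀ ℕ) =>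
        (coeff p.1 (column A p.2) * monoEval s p.2) * monoEval x p.1) (F (Sum.elim x s)) := by
    refine (joinExp.toEquiv.hasSum_iff.2 (hall hx hs)).congr_fun fun p => ?_
    rw [coeff_column, mul_assoc, mul_comm (monoEval s p.2), ← monoEval_joinExp]
    rfl
  obtain ⟨t, ht⟩ := (tendsto_primePoint.eventually hpx).exists
  filter_upwards [hps] with s hs
  have hcol (α : ι →₀ ℕ) : Summable fun γ => coeff α (column A γ) * monoEval s γ := by
    refine summable_of_hasSum_prod_mul
      (u := fun α γ => coeff α (column A γ) * monoEval s γ) (hjoin ht hs) ?_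
    rw [monoEval_primePoint]
    exact_mod_cast (weight_pos t α).ne'
  refine ⟨fun α => ∑' γ, coeff α (column A γ) * monoEval s γ, ?_, fun α => (hcol α).hasSum⟩
  filter_upwards [hpx] with x hx
  exact hasSum_tsum_mul (u := fun α γ => coeff α (column A γ) * monoEval s γ) (hjoin hx hs) hcol

/-- The series all of whose coefficients of Gödel number at most `K` vanish. -/
noncomputable def vanishing (K : ℕ) : Submodule ℂ (MvPowerSeries ι ℂ) where
  carrier := {a | ∀ α, godel α ≤ K → coeff α a = 0}
  add_mem' ha hb α hα := by rw [map_add, ha α hα, hb α hα, add_zero]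
  zero_mem' _ _ := map_zero _
  smul_mem' c a ha α hα := by rw [coeff_smul, ha α hα, mul_zero]

lemma mem_of_eventually_hasSum_mem {K : ℕ} {W : Submodule ℂ (MvPowerSeries ι ℂ)}
    (hW : vanishing K ≤ W) (B : (κ →₀ ℕ) → MvPowerSeries ι ℂ)
    (h : ∀ᶠ s in 𝓝 (0 : κ → ℂ), ∃ c ∈ W,
      ∀ α, HasSum (fun γ => coeff α (B γ) * monoEval s γ) (coeff α c)) (γ : κ →₀ ℕ) : B γ ∈ W := by
  classical
  by_contra hγ
  obtain ⟨ℓ, hℓ, hℓW⟩ := Submodule.exists_le_ker_of_notMem hγ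
  let t := (finite_godel_le (σ := ι) K).toFinset
  have ht {α} : α ∈ t ↔ godel α ≤ K := Set.Finite.mem_toFinset _
  have hexp (a) : ℓ a = ∑ α ∈ t, coeff α a * ℓ (monomial α 1) := by
    have h1 : a - ∑ α ∈ t, coeff α a • monomial α 1 ∈ vanishing K := by
      intro β hβ
      rw [map_sub, map_sum, Finset.sum_eq_single_of_mem β (ht.2 hβ)]
      · simp
      · intro α _ hα
        simp [coeff_monomial, hα.symm]
    have h2 := hℓW (hW h1)
    rw [LinearMap.mem_ker, map_sub, sub_eq_zero] at h2
    simpa using h2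
  have h0 : HasTaylor 0 (fun γ => ℓ (B γ) : MvPowerSeries κ ℂ) := by
    filter_upwards [h] with s hs
    obtain ⟨c, hc, hsum⟩ := hs
    have h1 := hasSum_sum fun α (_ : α ∈ t) => (hsum α).mul_right (ℓ (monomial α 1))
    rw [← hexp, LinearMap.mem_ker.1 (hℓW hc)] at h1
    refine h1.congr_fun fun γ => ?_
    change ℓ (B γ) * _ = _
    rw [hexp, Finset.sum_mul]
    exact Finset.sum_congr rfl fun _ _ => by ring
  exact hℓ (congrFun h0.eq_zero γ)

/-- A power series in the first group of variables, viewed in both groups of variables. -/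
noncomputable def lift (a : MvPowerSeries ι ℂ) : MvPowerSeries (ι ⊕ κ) ℂ :=
  open Classical in
  fun β => if (joinExp.symm β).2 = 0 then coeff (joinExp.symm β).1 a else 0

omit [Fintype ι] [Fintype κ] in
open Classical in
lemma coeff_lift (a : MvPowerSeries ι ℂ) (p : (ι →₀ ℕ) × (κ →₀ ℕ)) :
    coeff (joinExp p) (lift a) = if p.2 = 0 then coeff p.1 a else 0 := by
  change (if (joinExp.symm (joinExp p)).2 = 0 then coeff (joinExp.symm (joinExp p)).1 a else 0) = _
  rw [AddEquiv.symm_apply_apply]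

lemma HasTaylor.lift {f : (ι → ℂ) → ℂ} {a : MvPowerSeries ι ℂ} (h : HasTaylor f a) :
    HasTaylor (fun z : ι ⊕ κ → ℂ => f (z ∘ Sum.inl)) (lift a) := by
  have hlim : Tendsto (fun z : ι ⊕ κ → ℂ => z ∘ Sum.inl) (𝓝 0) (𝓝 0) := by
    have : Continuous fun z : ι ⊕ κ → ℂ => z ∘ Sum.inl := by fun_prop
    exact this.tendsto 0
  filter_upwards [hlim.eventually h] with z hz
  have hinj : Function.Injective fun α : ι →₀ ℕ => joinExp (α, (0 : κ →₀ ℕ)) := fun α α' hα =>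
    congrArg Prod.fst (joinExp.injective hα)
  refine (hinj.hasSum_iff fun β hβ => ?_).1 (hz.congr_fun fun α => ?_)
  · obtain ⟨p, rfl⟩ := joinExp.surjective β
    rw [coeff_lift, if_neg, zero_mul]
    rintro hp
    exact hβ ⟨p.1, by rw [← hp]⟩
  · have hz' : z = Sum.elim (z ∘ Sum.inl) (z ∘ Sum.inr) := (Sum.elim_comp_inl_inr z).symm
    rw [Function.comp_apply, coeff_lift, if_pos rfl, hz', monoEval_joinExp]
    simp [monoEval]

omit [Fintype ι] [Fintype κ] in
lemma coeff_mul_lift (Q : MvPowerSeries (ι ⊕ κ) ℂ) (a : MvPowerSeries ι ℂ)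
    (α : ι →₀ ℕ) (γ : κ →₀ ℕ) :
    coeff (joinExp (α, γ)) (Q * lift a) = coeff α (column Q γ * a) := by
  classical
  rw [coeff_mul, coeff_mul]
  refine (Finset.sum_of_injOn (fun p => (joinExp (p.1, γ), joinExp (p.2, 0))) ?_ ?_ ?_ ?_).symm
  · intro p _ p' _ h
    simp only [Prod.mk.injEq, EmbeddingLike.apply_eq_iff_eq] at h
    exact Prod.ext h.1.1 h.2.1
  · intro p hp
    rw [Finset.mem_coe, Finset.HasAntidiagonal.mem_antidiagonal] at hp ⊢
    rw [← map_add, Prod.mk_add_mk, hp, add_zero]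
  · rintro ⟨b, b'⟩ hb hb'
    obtain ⟨⟨α₁, γ₁⟩, rfl⟩ := joinExp.surjective b
    obtain ⟨⟨α₂, γ₂⟩, rfl⟩ := joinExp.surjective b'
    rw [Finset.HasAntidiagonal.mem_antidiagonal] at hb
    rw [← map_add, EmbeddingLike.apply_eq_iff_eq, Prod.mk_add_mk, Prod.mk.injEq] at hb
    rw [coeff_lift, if_neg, mul_zero]
    rintro (rfl : γ₂ = 0)
    refine hb' ⟨(α₁, α₂), Finset.HasAntidiagonal.mem_antidiagonal.2 hb.1, ?_⟩
    rw [← hb.2, add_zero]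
  · intro p _
    rw [coeff_lift, if_pos rfl, coeff_column]

/-- Ideal membership of all columns up to terms of high order gives approximate membership. -/
lemma exists_approx {k : ℕ} (a : Fin k → MvPowerSeries ι ℂ) (A : MvPowerSeries (ι ⊕ κ) ℂ)
    (h : ∀ K γ, column A γ ∈
      (Ideal.span (Set.range a)).restrictScalars ℂ ⊔ vanishing K) (K : ℕ) :
    ∃ Q : Fin k → convergent (ι ⊕ κ), ∀ β, godel β ≤ K →
      coeff β A = coeff β (∑ i, (Q i : MvPowerSeries (ι ⊕ κ) ℂ) * lift (a i)) := by
  obtain ⟨L, hL⟩ : ∃ L, ∀ β : ι ⊕ κ →₀ ℕ, godel β ≤ K → godel (joinExp.symm β).1 ≤ L := by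
    obtain ⟨L, hL⟩ := ((finite_godel_le (σ := ι ⊕ κ) K).image
      fun β => godel (joinExp.symm β).1).bddAbove
    exact ⟨L, fun β hβ => hL ⟨β, hβ, rfl⟩⟩
  have hq (γ : κ →₀ ℕ) : ∃ q : Fin k → MvPowerSeries ι ℂ, ∀ α, godel α ≤ L →
      coeff α (column A γ) = coeff α (∑ i, q i * a i) := by
    obtain ⟨b, hb, v, hv, hbv⟩ := Submodule.mem_sup.1 (h L γ)
    obtain ⟨q, rfl⟩ := Ideal.mem_span_range_iff_exists_fun.1 hb
    exact ⟨q, fun α hα => by rw [← hbv, map_add, hv α hα, add_zero]⟩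
  choose q hq using hq
  let Q (i : Fin k) : MvPowerSeries (ι ⊕ κ) ℂ :=
    fun β => coeff (joinExp.symm β).1 (q (joinExp.symm β).2 i)
  have hQ (i : Fin k) (γ) : column (Q i) γ = q γ i := by
    ext α
    rw [coeff_column]
    change coeff (joinExp.symm (joinExp (α, γ))).1 (q (joinExp.symm (joinExp (α, γ))).2 i) = _
    rw [AddEquiv.symm_apply_apply]
  refine ⟨fun i => ⟨truncGodel K (Q i), 0, wnorm_truncGodel_ne_top 0 K _⟩, fun β hβ => ?_⟩
  have htr (i : Fin k) :
      coeff β (truncGodel K (Q i) * lift (a i)) = coeff β (Q i * lift (a i)) := by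
    classical
    rw [coeff_mul, coeff_mul]
    refine Finset.sum_congr rfl fun p hp => ?_
    have hp' : p.1 ≤ β := by
      rw [← Finset.HasAntidiagonal.mem_antidiagonal.1 hp]
      exact le_self_add
    rw [coeff_truncGodel, if_pos ((godel_le_of_le hp').trans hβ)]
  have hα := hL β hβ
  rw [map_sum, Finset.sum_congr rfl fun i _ => htr i]
  obtain ⟨⟨α, γ⟩, rfl⟩ := joinExp.surjective β
  rw [AddEquiv.symm_apply_apply] at hα
  rw [← coeff_column, hq γ α hα, map_sum]
  exact Finset.sum_congr rfl fun i _ => by rw [coeff_mul_lift, hQ]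

theorem exists_eventually_eq_sum {k : ℕ} {f : Fin k → (ι → ℂ) → ℂ}
    (hf : ∀ i, AnalyticAt ℂ (f i) 0) {F : (ι ⊕ κ → ℂ) → ℂ} (hF : AnalyticAt ℂ F 0)
    (hslice : ∀ᶠ s in 𝓝 (0 : κ → ℂ), ∃ G : Fin k → (ι → ℂ) → ℂ, (∀ i, AnalyticAt ℂ (G i) 0) ∧
      ∀ᶠ x in 𝓝 0, F (Sum.elim x s) = ∑ i, G i x * f i x) :
    ∃ G : Fin k → (ι ⊕ κ → ℂ) → ℂ, (∀ i, AnalyticAt ℂ (G i) 0) ∧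
      ∀ᶠ z in 𝓝 0, F z = ∑ i, G i z * f i (z ∘ Sum.inl) := by
  choose a ha using fun i => exists_hasTaylor_of_analyticAt (hf i)
  obtain ⟨A, hA⟩ := exists_hasTaylor_of_analyticAt hF
  have hcol (K γ) : column A γ ∈ (Ideal.span (Set.range a)).restrictScalars ℂ ⊔ vanishing K := by
    refine mem_of_eventually_hasSum_mem le_sup_right (column A) ?_ γ
    filter_upwards [hA.eventually_slice, hslice] with s hs hs'
    obtain ⟨c, hc, hsum⟩ := hs
    obtain ⟨G, hG, hGF⟩ := hs'
    choose b hb using fun i => exists_hasTaylor_of_analyticAt (hG i)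
    have hc' : c = ∑ i, b i * a i :=
      hc.unique ((HasTaylor.sum fun i _ => (hb i).mul (ha i)).congr (hGF.mono fun x hx => hx.symm))
    refine ⟨c, Submodule.mem_sup_left ?_, hsum⟩
    exact Ideal.mem_span_range_iff_exists_fun.2 ⟨b, hc'.symm⟩
  let a' (i : Fin k) : convergent (ι ⊕ κ) := ⟨lift (a i), (ha i).lift.mem_convergent⟩
  have hmem : (⟨A, hA.mem_convergent⟩ : convergent (ι ⊕ κ)) ∈ Ideal.span (Set.range a') := by
    refine mem_ideal_of_forall_approx _ _ fun K => ?_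
    obtain ⟨Q, hQ⟩ := exists_approx a A hcol K
    refine ⟨∑ i, Q i * a' i, Ideal.mem_span_range_iff_exists_fun.2 ⟨Q, rfl⟩, fun β hβ => ?_⟩
    simpa [a'] using hQ β hβ
  obtain ⟨c, hc⟩ := Ideal.mem_span_range_iff_exists_fun.1 hmem
  choose G hG using fun i => exists_hasTaylor (c i).2
  refine ⟨G, fun i => (hG i).analyticAt, ?_⟩
  have hsum : A = ∑ i, (c i : MvPowerSeries (ι ⊕ κ) ℂ) * lift (a i) := by
    simpa [a'] using (congrArg Subtype.val hc).symm
  have h1 := HasTaylor.sum (t := Finset.univ) fun i _ => (hG i).mul (ha i).lift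
  rw [← hsum] at h1
  filter_upwards [hA, h1] with z hz hz'
  exact hz.unique hz'

end Slices

end ConvergentSeries

/-- **Lemma 1.2 of "Relative Morsification Theory"** (in the form of the remark following it):
if `F` is analytic near `(0,0)` in `ℂⁿ × ℂʳ`, the `fᵢ` are analytic near `0` in `ℂⁿ`
(independent of the parameter `s`), and every slice `F(·,s)` (for `s` in a neighbourhood of `0`)
belongs, on a neighbourhood of `0`, to the ideal generated by `f₁, …, f_k`, then the germ of `F`
at `(0,0)` belongs to the ideal generated by the `fᵢ` in the ring of analytic germs on
`ℂⁿ × ℂʳ`. -/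
theorem unfolding_ideal_membership
    (n r k : ℕ)
    (f : Fin k → (Fin n → ℂ) → ℂ)
    (U : Set (Fin n → ℂ)) (hU : U ∈ nhds (0 : Fin n → ℂ))
    (hf : ∀ i, AnalyticOnNhd ℂ (f i) U)
    (F : (Fin n → ℂ) × (Fin r → ℂ) → ℂ)
    (W : Set ((Fin n → ℂ) × (Fin r → ℂ)))
    (hW : W ∈ nhds ((0, 0) : (Fin n → ℂ) × (Fin r → ℂ)))
    (hF : AnalyticOnNhd ℂ F W)
    (S : Set (Fin r → ℂ)) (hS : S ∈ nhds (0 : Fin r → ℂ))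
    (hslice : ∀ s ∈ S, ∃ V ∈ nhds (0 : Fin n → ℂ), ∃ G : Fin k → (Fin n → ℂ) → ℂ,
      (∀ i, AnalyticOnNhd ℂ (G i) V) ∧
      ∀ x ∈ V, F (x, s) = ∑ i, G i x * f i x) :
    ∃ Ω ∈ nhds ((0, 0) : (Fin n → ℂ) × (Fin r → ℂ)),
      ∃ G : Fin k → (Fin n → ℂ) × (Fin r → ℂ) → ℂ,
        (∀ i, AnalyticOnNhd ℂ (G i) Ω) ∧
        ∀ p ∈ Ω, F p = ∑ i, G i p * f i p.1 := by
  let e : (Fin n ⊕ Fin r → ℂ) ≃L[ℂ] (Fin n → ℂ) × (Fin r → ℂ) :=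
    (LinearEquiv.sumArrowLequivProdArrow (Fin n) (Fin r) ℂ ℂ).toContinuousLinearEquiv
  have he0 : e.symm (0, 0) = 0 := map_zero e.symm
  obtain ⟨G, hG, hGF⟩ := ConvergentSeries.exists_eventually_eq_sum (F := F ∘ e)
    (fun i => hf i 0 (mem_of_mem_nhds hU))
    ((hF _ (mem_of_mem_nhds hW)).comp_of_eq (e.toContinuousLinearMap.analyticAt 0) (map_zero e)) (by
      filter_upwards [hS] with s hs
      obtain ⟨V, hV, G, hG, hGF⟩ := hslice s hs
      exact ⟨G, fun i => hG i 0 (mem_of_mem_nhds hV), Filter.mem_of_superset hV hGF⟩)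
  have hGe (i) : AnalyticAt ℂ (G i ∘ e.symm) (0, 0) :=
    (hG i).comp_of_eq (e.symm.toContinuousLinearMap.analyticAt _) he0
  have hev : ∀ᶠ p in nhds ((0, 0) : (Fin n → ℂ) × (Fin r → ℂ)),
      (∀ i, AnalyticAt ℂ (G i ∘ e.symm) p) ∧ F p = ∑ i, (G i ∘ e.symm) p * f i p.1 := by
    refine (Filter.eventually_all.2 fun i => (hGe i).eventually_analyticAt).and ?_
    have := e.symm.continuous.tendsto (0, 0)
    rw [he0] at this
    filter_upwards [this.eventually hGF] with p hp
    have hinl : e.symm p ∘ Sum.inl = p.1 := rfl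
    simpa [hinl] using hp
  exact ⟨_, hev, fun i => G i ∘ e.symm, fun i p hp => hp.1 i, fun p hp => hp.2⟩
end

section
/- Let k be a commutative ring, R a commutative k-algebra, D : R → R a k-derivation, and I, J ideals of R such that D maps I into I. Then for every natural number c, D maps the ideal J^{c+1}·I into the ideal J^{c}·I. -/
/-- A derivation maps `J ^ (c + 1)` into `J ^ c`. -/
theorem Derivation.apply_mem_pow_of_mem_pow_succ
    {k : Type*} [CommRing k] {R : Type*} [CommRing R] [Algebra k R]
    (D : Derivation k R R) (J : Ideal R) (c : ℕ) {a : R} (ha : a ∈ J ^ (c + 1)) :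
    D a ∈ J ^ c := by
  induction c generalizing a with
  | zero => simp
  | succ c ih =>
    rw [pow_succ] at ha
    refine Submodule.mul_induction_on ha (fun x hx y hy => ?_) (fun x y hx hy => ?_)
    · rw [D.leibniz, smul_eq_mul, smul_eq_mul]
      refine add_mem (Ideal.mul_mem_right _ _ hx) ?_
      rw [pow_succ, mul_comm y]
      exact Ideal.mul_mem_mul (ih hx) hy
    · rw [map_add]
      exact add_mem hx hy

/-- The Leibniz-rule estimate which is the key computation of Lemmas 4.2 and 4.3 of
"Relative Morsification Theory": a `k`-derivation `D` of a commutative `k`-algebra `R`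
preserving an ideal `I` maps `J^{c+1}·I` into `J^{c}·I` for every ideal `J` and every
natural number `c`. -/
theorem derivation_maps_pow_mul_into_pow_mul
    (k : Type*) [CommRing k] (R : Type*) [CommRing R] [Algebra k R]
    (D : Derivation k R R) (I J : Ideal R)
    (hD : ∀ a ∈ I, D a ∈ I) :
    ∀ c : ℕ, ∀ a ∈ J ^ (c + 1) * I, D a ∈ J ^ c * I := by
  intro c a ha
  refine Submodule.mul_induction_on ha (fun x hx y hy => ?_) (fun x y hx hy => ?_)
  · rw [D.leibniz, smul_eq_mul, smul_eq_mul, mul_comm y]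
    exact add_mem (Ideal.mul_mem_mul (Ideal.pow_le_pow_right c.le_succ hx) (hD y hy))
      (Ideal.mul_mem_mul (D.apply_mem_pow_of_mem_pow_succ J c hx) hy)
  · rw [map_add]
    exact add_mem hx hy
end

section
/- Let k be a commutative ring and R a commutative Noetherian local k-algebra with maximal ideal 𝔪, let I be an ideal of R, let Θ_I denote the set of k-derivations D : R → R with D(I) ⊆ I, and for f ∈ R let τ(f) denote the R-submodule {D f : D ∈ Θ_I} of R. Let m be a natural number and f ∈ I with 𝔪^m·I ⊆ τ(f). Then for every g ∈ 𝔪^{m+2}·I one has 𝔪^m·I ⊆ τ(f+g). -/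
/-- The `R`-submodule `τ(f) = Θ_I(f) = {D f : D a k-derivation of R with D(I) ⊆ I}`
(the extended tangent space of `f` relative to the ideal `I`). -/
def extendedTangent (k : Type*) [CommRing k] (R : Type*) [CommRing R] [Algebra k R]
    (I : Ideal R) (f : R) : Submodule R R where
  carrier := {y | ∃ D : Derivation k R R, (∀ a ∈ I, D a ∈ I) ∧ D f = y}
  add_mem' := by
    rintro a b ⟨D1, hD1, rfl⟩ ⟨D2, hD2, rfl⟩
    exact ⟨D1 + D2, fun a ha => by
      simpa using I.add_mem (hD1 a ha) (hD2 a ha), by simp⟩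
  zero_mem' := ⟨0, fun a ha => by simp, by simp⟩
  smul_mem' := by
    rintro c a ⟨D, hD, rfl⟩
    exact ⟨c • D, fun a ha => by simpa using I.smul_mem c (hD a ha), by simp⟩

/-- A derivation preserving `I` maps `J ^ (n + 1) * I` into `J ^ n * I`. -/
theorem Derivation.apply_mem_pow_mul_of_mem_pow_succ_mul {k R : Type*} [CommRing k] [CommRing R]
    [Algebra k R] {I : Ideal R} (D : Derivation k R R) (hD : ∀ a ∈ I, D a ∈ I) (J : Ideal R)
    (n : ℕ) {x : R} (hx : x ∈ J ^ (n + 1) * I) : D x ∈ J ^ n * I := by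
  induction n generalizing x with
  | zero => simpa using hD x (Ideal.mul_le_right hx)
  | succ n ih =>
    rw [pow_succ', mul_assoc] at hx
    induction hx using Submodule.mul_induction_on' with
    | mem_mul_mem a ha y hy =>
      rw [D.leibniz, smul_eq_mul, smul_eq_mul, mul_comm y]
      refine add_mem ?_ (Ideal.mul_mem_left _ _ hy)
      rw [pow_succ', mul_assoc]
      exact Ideal.mul_mem_mul ha (ih hy)
    | add y _ z _ hy hz => simpa using add_mem hy hz

/-- Lemma 4.2 (`deter2`) of "Relative Morsification Theory": in a commutative Noetherian
local `k`-algebra `R` with maximal ideal `𝔪`, if `f ∈ I` satisfies `𝔪^m·I ⊆ τ(f)`, then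
for every `g ∈ 𝔪^{m+2}·I` one also has `𝔪^m·I ⊆ τ(f+g)`. -/
theorem pow_mul_le_extendedTangent_add
    (k : Type*) [CommRing k] (R : Type*) [CommRing R] [Algebra k R]
    [IsNoetherianRing R] [IsLocalRing R]
    (I : Ideal R) (m : ℕ) (f : R) (hf : f ∈ I)
    (h : IsLocalRing.maximalIdeal R ^ m * I ≤ extendedTangent k R I f) :
    ∀ g ∈ IsLocalRing.maximalIdeal R ^ (m + 2) * I,
      IsLocalRing.maximalIdeal R ^ m * I ≤ extendedTangent k R I (f + g) := by
  intro g hg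
  refine Submodule.le_of_le_smul_of_le_jacobson_bot (IsNoetherian.noetherian _)
    (IsLocalRing.maximalIdeal_le_jacobson ⊥) fun y hy => ?_
  obtain ⟨D, hD, rfl⟩ := h hy
  have hDg := D.apply_mem_pow_mul_of_mem_pow_succ_mul hD _ (m + 1) hg
  rw [pow_succ', mul_assoc] at hDg
  exact Submodule.mem_sup.2 ⟨D (f + g), ⟨D, hD, rfl⟩, -D g, neg_mem hDg, by simp⟩
end

section
/- Let k be a commutative ring and R a commutative Noetherian local k-algebra with maximal ideal 𝔪, let I be an ideal of R, let Θ_I denote the set of k-derivations D : R → R with D(I) ⊆ I, and for f ∈ R let τ(f) denote the R-submodule {D f : D ∈ Θ_I} of R. Let λ be a natural number such that I ∩ 𝔪^{n+λ} ⊆ 𝔪^{n}·I for every natural number n. Let f ∈ I be such that the R-module I/τ(f) has finite length equal to m. Then for every g ∈ I ∩ 𝔪^{λ+m+2} one has τ(f+g) = τ(f); in particular the R-module I/τ(f+g) also has length m. -/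
/-- A derivation maps the power `J ^ (n + 1)` of an ideal into `J ^ n`. -/
theorem Derivation.apply_mem_ideal_pow {k R : Type*} [CommRing k] [CommRing R] [Algebra k R]
    (D : Derivation k R R) (J : Ideal R) (n : ℕ) {x : R} (hx : x ∈ J ^ (n + 1)) :
    D x ∈ J ^ n := by
  induction n generalizing x with
  | zero => simp
  | succ n ih =>
    rw [pow_succ] at hx
    induction hx using Submodule.mul_induction_on' with
    | mem_mul_mem a ha b hb =>
      rw [D.leibniz, smul_eq_mul, smul_eq_mul]
      refine add_mem (Ideal.mul_mem_right _ _ ha) ?_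
      rw [pow_succ']
      exact Ideal.mul_mem_mul hb (ih ha)
    | add a _ b _ iha ihb =>
      rw [map_add]
      exact add_mem iha ihb

/-- If `N'` covers `N` and `N'` is finitely generated over a local ring with maximal ideal `𝔪`,
then `𝔪 • N' ≤ N`. -/
theorem CovBy.maximalIdeal_smul_le {R M : Type*} [CommRing R] [IsLocalRing R] [AddCommGroup M]
    [Module R M] {N N' : Submodule R M} (h : N ⋖ N') (hN' : N'.FG) :
    IsLocalRing.maximalIdeal R • N' ≤ N := by
  rcases h.eq_or_eq (c := N ⊔ IsLocalRing.maximalIdeal R • N') le_sup_left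
    (sup_le h.le Submodule.smul_le_right) with h1 | h1
  · exact sup_eq_left.mp h1
  · exact absurd (Submodule.le_of_le_smul_of_le_jacobson_bot hN'
      (IsLocalRing.maximalIdeal_le_jacobson _) h1.ge) h.lt.not_ge

/-- Over a local ring, the power `𝔪 ^ i` of the maximal ideal kills the `i`-th term of a
composition series starting at `⊥`. -/
theorem CompositionSeries.maximalIdeal_pow_smul_eq_bot {R M : Type*} [CommRing R] [IsLocalRing R]
    [AddCommGroup M] [Module R M] [IsNoetherian R M] (s : CompositionSeries (Submodule R M))
    (hs : s.head = ⊥) (i : Fin (s.length + 1)) :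
    IsLocalRing.maximalIdeal R ^ (i : ℕ) • s i = ⊥ := by
  induction i using Fin.induction with
  | zero =>
    change _ • s.head = ⊥
    rw [hs, Submodule.smul_bot]
  | succ i ih =>
    have hcov : s i.castSucc ⋖ s i.succ := s.step i
    rw [Fin.val_succ, pow_succ, Submodule.mul_smul, eq_bot_iff, ← ih]
    exact Submodule.smul_mono le_rfl (hcov.maximalIdeal_smul_le (IsNoetherian.noetherian _))

/-- Over a local ring, if `I / (I ∩ N)` has a composition series of length `m`, then
`𝔪 ^ m * I ≤ N`. -/
theorem CompositionSeries.maximalIdeal_pow_mul_le {R : Type*} [CommRing R] [IsNoetherianRing R]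
    [IsLocalRing R] {I : Ideal R} {N : Submodule R R}
    (s : CompositionSeries (Submodule R (↥I ⧸ Submodule.comap I.subtype N)))
    (hs : s.head = ⊥) (hs' : s.last = ⊤) :
    IsLocalRing.maximalIdeal R ^ s.length * I ≤ N := by
  have h := s.maximalIdeal_pow_smul_eq_bot hs (Fin.last _)
  change _ • s.last = ⊥ at h
  rw [hs', Fin.val_last] at h
  refine Ideal.mul_le.mpr fun a ha b hb => ?_
  have hab : a • Submodule.Quotient.mk (p := Submodule.comap I.subtype N) ⟨b, hb⟩ ∈
      (⊥ : Submodule R (↥I ⧸ Submodule.comap I.subtype N)) :=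
    h ▸ Submodule.smul_mem_smul ha Submodule.mem_top
  rw [Submodule.mem_bot, ← Submodule.Quotient.mk_smul, Submodule.Quotient.mk_eq_zero] at hab
  exact hab

/-- The algebraic heart of Lemma 4.3 (`deter2.5`) of "Relative Morsification Theory":
let `R` be a commutative Noetherian local `k`-algebra with maximal ideal `𝔪`, `I` an ideal
with uniform Artin–Rees constant `L` (i.e. `I ∩ 𝔪^{n+L} ⊆ 𝔪^n·I` for every `n`), and let
`f ∈ I` be such that `I/τ(f)` has finite length `m` (i.e. admits a composition series from
`⊥` to `⊤` of length `m`).  Then for every `g ∈ I ∩ 𝔪^{L+m+2}` one has `τ(f+g) = τ(f)`,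
and `I/τ(f+g)` again has length `m`. -/
theorem extendedTangent_determined
    (k : Type*) [CommRing k] (R : Type*) [CommRing R] [Algebra k R]
    [IsNoetherianRing R] [IsLocalRing R]
    (I : Ideal R) (L : ℕ)
    (hAR : ∀ n : ℕ, I ⊓ IsLocalRing.maximalIdeal R ^ (n + L) ≤
      IsLocalRing.maximalIdeal R ^ n * I)
    (m : ℕ) (f : R) (hf : f ∈ I)
    (hlen : ∃ s : CompositionSeries
        (Submodule R (↥I ⧸ Submodule.comap I.subtype (extendedTangent k R I f))),
      s.head = ⊥ ∧ s.last = ⊤ ∧ s.length = m) :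
    ∀ g ∈ I ⊓ IsLocalRing.maximalIdeal R ^ (L + m + 2),
      extendedTangent k R I (f + g) = extendedTangent k R I f ∧
      ∃ s : CompositionSeries
          (Submodule R (↥I ⧸ Submodule.comap I.subtype (extendedTangent k R I (f + g)))),
        s.head = ⊥ ∧ s.last = ⊤ ∧ s.length = m := by
  obtain ⟨s, hs, hs', rfl⟩ := hlen
  rintro g ⟨hgI, hg⟩
  have hpow := s.maximalIdeal_pow_mul_le hs hs'
  have hDg (D : Derivation k R R) (hD : ∀ a ∈ I, D a ∈ I) :
      D g ∈ IsLocalRing.maximalIdeal R • extendedTangent k R I f := by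
    have h1 : D g ∈ I ⊓ IsLocalRing.maximalIdeal R ^ (s.length + 1 + L) := by
      refine ⟨hD g hgI, D.apply_mem_ideal_pow _ _ ?_⟩
      rwa [show s.length + 1 + L + 1 = L + s.length + 2 by omega]
    have h2 := hAR _ h1
    rw [pow_succ', mul_assoc] at h2
    exact Submodule.smul_mono le_rfl hpow h2
  have heq : extendedTangent k R I (f + g) = extendedTangent k R I f := by
    refine le_antisymm ?_ (Submodule.le_of_le_smul_of_le_jacobson_bot
      (IsNoetherian.noetherian _) (IsLocalRing.maximalIdeal_le_jacobson _) ?_)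
    · rintro _ ⟨D, hD, rfl⟩
      rw [map_add]
      exact add_mem ⟨D, hD, rfl⟩ (Submodule.smul_le_right (hDg D hD))
    · rintro _ ⟨D, hD, rfl⟩
      have h : D f = D (f + g) + -D g := by rw [map_add, add_neg_cancel_right]
      rw [h]
      exact Submodule.add_mem_sup ⟨D, hD, rfl⟩ (neg_mem (hDg D hD))
  refine ⟨heq, ?_⟩
  rw [heq]
  exact ⟨s, hs, hs', rfl⟩
end

section
/- Let A be a commutative ring, let R = A[x₁,…,x_n] be the multivariate polynomial ring, and let I' be an ideal of R. Define the primitive ideal ∫I' := {f ∈ R : f ∈ I' and ∂f/∂x_i ∈ I' for every i = 1,…,n}. Then: (a) ∫I' is an ideal of R; and (b) for every A-derivation X : R → R with X(I') ⊆ I', one has X(∫I') ⊆ ∫I'. -/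
open MvPolynomial

theorem Derivation.sum_apply {ι R A M : Type*} [CommSemiring R] [CommSemiring A] [Algebra R A]
    [AddCommMonoid M] [Module A M] [Module R M] (s : Finset ι) (D : ι → Derivation R A M) (a : A) :
    (∑ i ∈ s, D i) a = ∑ i ∈ s, D i a := by
  rw [← Derivation.coeFnAddMonoidHom_apply, map_sum, Finset.sum_apply]
  rfl

theorem MvPolynomial.derivation_eq_sum_smul_pderiv {σ A : Type*} [Fintype σ] [CommRing A]
    (D : Derivation A (MvPolynomial σ A) (MvPolynomial σ A)) :
    D = ∑ i, D (X i) • pderiv i := by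
  classical
  refine derivation_ext fun j => ?_
  rw [Derivation.sum_apply]
  simp [pderiv_X, Pi.single_apply]

theorem MvPolynomial.derivation_mem_of_forall_pderiv_mem {σ A : Type*} [Fintype σ] [CommRing A]
    (D : Derivation A (MvPolynomial σ A) (MvPolynomial σ A)) {I : Ideal (MvPolynomial σ A)}
    {f : MvPolynomial σ A} (hf : ∀ i, pderiv i f ∈ I) : D f ∈ I := by
  rw [derivation_eq_sum_smul_pderiv D, Derivation.sum_apply]
  exact I.sum_mem fun i _ => I.mul_mem_left _ (hf i)

/-- The primitive ideal of `I`: the elements of `I` all of whose partial derivatives lie in `I`. -/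
def MvPolynomial.primitiveIdeal {σ A : Type*} [CommRing A] (I : Ideal (MvPolynomial σ A)) :
    Ideal (MvPolynomial σ A) where
  carrier := {f | f ∈ I ∧ ∀ i, pderiv i f ∈ I}
  zero_mem' := by simp
  add_mem' hf hg := ⟨I.add_mem hf.1 hg.1, fun i => by
    rw [map_add]
    exact I.add_mem (hf.2 i) (hg.2 i)⟩
  smul_mem' c f hf := ⟨I.mul_mem_left c hf.1, fun i => by
    rw [smul_eq_mul, Derivation.leibniz]
    exact I.add_mem (I.mul_mem_left _ (hf.2 i)) (I.mul_mem_right _ hf.1)⟩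

/-- Section 1 of "Relative Morsification Theory": for an ideal `I'` of the polynomial ring
`R = A[x₁,…,x_n]`, the primitive ideal `∫I' = {f : f ∈ I' and ∂f/∂xᵢ ∈ I' for all i}`
is (a) an ideal of `R`, and (b) it is preserved by every `A`-derivation `X` of `R`
which preserves `I'` (the content of the inclusion `Θ_{I',e} ⊆ Θ_{∫I',e}`). -/
theorem primitive_ideal_isIdeal_and_derivation_invariant
    (A : Type*) [CommRing A] (n : ℕ) (I' : Ideal (MvPolynomial (Fin n) A)) :
    ∃ P : Ideal (MvPolynomial (Fin n) A),
      (∀ f, f ∈ P ↔ f ∈ I' ∧ ∀ i : Fin n, pderiv i f ∈ I') ∧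
      ∀ X : Derivation A (MvPolynomial (Fin n) A) (MvPolynomial (Fin n) A),
        (∀ a ∈ I', X a ∈ I') → ∀ f ∈ P, X f ∈ P := by
  refine ⟨primitiveIdeal I', fun f => Iff.rfl, fun X hX f hf => ⟨hX f hf.1, fun j => ?_⟩⟩
  have h : pderiv j (X f) =
      ⁅(pderiv j : Derivation A (MvPolynomial (Fin n) A) _), X⁆ f + X (pderiv j f) := by
    rw [Derivation.commutator_apply, sub_add_cancel]
  rw [h]
  exact I'.add_mem (derivation_mem_of_forall_pderiv_mem _ hf.2) (hX _ (hf.2 j))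
end

section
/- Let K be a field of characteristic zero, let R = K[x₁,…,x_n] be the polynomial ring, let 𝔪 = (x₁,…,x_n) be the ideal generated by the variables, and let k ≥ 1 be a natural number. A K-derivation X : R → R satisfies X(𝔪^k) ⊆ 𝔪^k if and only if X(x_i) ∈ 𝔪 for every i = 1,…,n. -/
open MvPolynomial

/-- A derivation mapping an ideal into itself maps every power of that ideal into itself. -/
theorem Derivation.apply_mem_pow {R A : Type*} [CommSemiring R] [CommRing A] [Algebra R A]
    (D : Derivation R A A) {I : Ideal A} (hD : ∀ f ∈ I, D f ∈ I) (k : ℕ) :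
    ∀ f ∈ I ^ k, D f ∈ I ^ k := by
  induction k with
  | zero => simp
  | succ k ih =>
    intro f hf
    rw [pow_succ] at hf ⊢
    induction hf using Submodule.mul_induction_on' with
    | mem_mul_mem a ha b hb =>
      rw [D.leibniz, smul_eq_mul, smul_eq_mul, mul_comm b]
      exact add_mem (Ideal.mul_mem_mul ha (hD b hb)) (Ideal.mul_mem_mul (ih a ha) hb)
    | add a _ b _ ha hb => simpa using add_mem ha hb

/-- A derivation mapping a generating set of an ideal into the ideal maps the ideal into itself. -/
theorem Derivation.apply_mem_span {R A : Type*} [CommSemiring R] [CommRing A] [Algebra R A]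
    (D : Derivation R A A) {s : Set A} (hD : ∀ f ∈ s, D f ∈ Ideal.span s) :
    ∀ f ∈ Ideal.span s, D f ∈ Ideal.span s := by
  intro f hf
  induction hf using Submodule.span_induction with
  | mem f hf => exact hD f hf
  | zero => simp
  | add a b _ _ ha hb => simpa using add_mem ha hb
  | smul a b hb ih =>
    rw [smul_eq_mul, D.leibniz, smul_eq_mul, smul_eq_mul]
    exact add_mem (Ideal.mul_mem_left _ a ih) (Ideal.mul_mem_right _ _ hb)

/-- The first example of Section 11 of "Relative Morsification Theory": for the ideal
`I = 𝔪^k` (with `𝔪 = (x₁,…,x_n)` the ideal of the variables of `K[x₁,…,x_n]`, `char K = 0`,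
`k ≥ 1`), a `K`-derivation `X` preserves `𝔪^k` if and only if `X(xᵢ) ∈ 𝔪` for every `i`;
that is, `Θ_{𝔪^k,e} = 𝔪·Θ`. -/
theorem derivation_preserves_pow_maximal_iff
    (K : Type*) [Field K] [CharZero K] (n : ℕ) (k : ℕ) (hk : 1 ≤ k)
    (X : Derivation K (MvPolynomial (Fin n) K) (MvPolynomial (Fin n) K)) :
    (∀ f ∈ (Ideal.span (Set.range (MvPolynomial.X : Fin n → MvPolynomial (Fin n) K))) ^ k,
        X f ∈ (Ideal.span (Set.range (MvPolynomial.X : Fin n → MvPolynomial (Fin n) K))) ^ k)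
      ↔ ∀ i : Fin n,
        X (MvPolynomial.X i) ∈
          Ideal.span (Set.range (MvPolynomial.X : Fin n → MvPolynomial (Fin n) K)) := by
  refine ⟨fun h i => ?_, fun h =>
    X.apply_mem_pow (X.apply_mem_span (Set.forall_mem_range.mpr h)) k⟩
  have hpow := h _ (Ideal.pow_mem_pow (Ideal.subset_span (Set.mem_range_self i)) k)
  have hcoeff := (mem_pow_idealOfVars_iff' k _).mp hpow (Finsupp.single i (k - 1))
    (by rw [Finsupp.degree_single]; omega)
  rw [X.leibniz_pow, smul_eq_mul, coeff_smul, X_pow_eq_monomial,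
    coeff_monomial_mul'] at hcoeff
  have hconst : coeff 0 (X (MvPolynomial.X i)) = 0 := by
    simpa [Nat.one_le_iff_ne_zero.mp hk] using hcoeff
  rw [← pow_one (Ideal.span _)]
  refine (mem_pow_idealOfVars_iff' 1 _).mpr fun x hx => ?_
  rwa [(Finsupp.degree_eq_zero_iff x).mp (Nat.lt_one_iff.mp hx)]
end
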